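/- Let K and L be convex bodies in ℝ⁴ having countably many diameters, and let ζ ∈ S³ be such that K has a diameter d_K(ζ) parallel to ζ. Assume that for every w ∈ S³ with w·ζ = 0 the projections K|w^⊥ and L|w^⊥ are directly congruent. Then L has a diameter parallel to ζ; the set Ω = {w ∈ S²(ζ) : (A_K ∪ A_L) ∩ S²(w) = {±ζ}} is everywhere dense in S²(ζ); for every w ∈ Ω, every rotation χ_w ∈ SO(3, S²(w)) satisfying χ_w(K|w^⊥) = L|w^⊥ + a_w for some a_w ∈ w^⊥ maps ζ to ±ζ; and ω_K(ζ) = ω_L(ζ). -/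

import Mathlib

noncomputable section

open scoped RealInnerProductSpace

/-- `ℝ⁴` as a Euclidean space. -/
abbrev E4 := EuclideanSpace ℝ (Fin 4)

/-- The unit sphere `S³` in `ℝ⁴`. -/
def sph : Set E4 := Metric.sphere (0 : E4) 1

/-- The great subsphere `S²(w) = {θ ∈ S³ : θ·w = 0}`. -/
def S2 (w : E4) : Set E4 := {θ ∈ sph | ⟪θ, w⟫ = 0}

/-- The orthogonal transformation `𝒪` determined by `ζ`: for a unit vector `ζ` the map
`x ↦ 2⟪x,ζ⟫ζ - x` satisfies `𝒪 ζ = ζ` and `𝒪 = -I` on `ζ^⊥`. -/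
def Ocal (ζ x : E4) : E4 := (2 * ⟪x, ζ⟫) • ζ - x

/-- `φ` is (the extension to `ℝ⁴` of) an element of `SO(3, S²(w))`:
a linear isometry of `ℝ⁴` fixing `w`, of determinant `1`, i.e. a rotation
of the `3`-dimensional subspace `w^⊥`. -/
def IsRot (w : E4) (φ : E4 ≃ₗᵢ[ℝ] E4) : Prop :=
  φ w = w ∧ LinearMap.det (φ.toLinearEquiv : E4 →ₗ[ℝ] E4) = 1

/-- `φ ∈ SO(3, S²(w))` is a rotation by the angle `α·π` around the axis `u ∈ S²(w)`:
it fixes `w` and `u`, and turns the plane orthogonal to `w` and `u` by the angle `α·π`. -/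
def IsRotAngleAbout (w u : E4) (α : ℝ) (φ : E4 ≃ₗᵢ[ℝ] E4) : Prop :=
  IsRot w φ ∧ φ u = u ∧
    ∀ v : E4, ⟪v, w⟫ = 0 → ⟪v, u⟫ = 0 →
      ⟪φ v, v⟫ = Real.cos (α * Real.pi) * ⟪v, v⟫

/-- The support function of `K`. -/
def suppFn (K : Set E4) (x : E4) : ℝ := sSup ((fun y => ⟪x, y⟫) '' K)

/-- The width function of `K`. -/
def widthFn (K : Set E4) (x : E4) : ℝ := suppFn K x + suppFn K (-x)

/-- The maximal width of `K`. -/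
def maxWidth (K : Set E4) : ℝ := sSup (widthFn K '' sph)

/-- Directions of diameters of a convex body `K`: the set of `θ ∈ S³` at which the
width function attains its maximum. -/
def DiamDirs (K : Set E4) : Set E4 := {θ ∈ sph | widthFn K θ = maxWidth K}

/-- Orthogonal projection onto the hyperplane `w^⊥` (for a unit vector `w`). -/
def projHyp (w x : E4) : E4 := x - ⟪x, w⟫ • w

/-- A convex body: a compact convex set with nonempty interior. -/
def IsConvexBody (K : Set E4) : Prop := IsCompact K ∧ Convex ℝ K ∧ (interior K).Nonempty

/-- Subsets `D₁`, `D₂` of `w^⊥` are directly congruent: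
`φ(D₁) = D₂ + a` for some rotation `φ ∈ SO(3, w^⊥)` and some `a ∈ w^⊥`. -/
def DirCong (w : E4) (D₁ D₂ : Set E4) : Prop :=
  ∃ φ : E4 ≃ₗᵢ[ℝ] E4, IsRot w φ ∧
    ∃ a : E4, ⟪a, w⟫ = 0 ∧ φ '' D₁ = (fun x => x + a) '' D₂

/-- The subset `D` of the `3`-dimensional subspace `w^⊥` has a `(u, π)`-symmetry:
`φ(D) = D + a` for the rotation `φ` by the angle `π` about `u` and some `a ∈ w^⊥`. -/
def HasPiSymSet (w u : E4) (D : Set E4) : Prop :=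
  ∃ φ : E4 ≃ₗᵢ[ℝ] E4, IsRotAngleAbout w u 1 φ ∧
    ∃ a : E4, ⟪a, w⟫ = 0 ∧ φ '' D = (fun x => x + a) '' D

/-- The subset `D` of `ζ^⊥` has a rigid motion symmetry: `φ(D) = D + a` for some
non-identical orthogonal transformation `φ ∈ O(3, ζ^⊥)` and some `a ∈ ζ^⊥`. -/
def HasRigidSym (ζ : E4) (D : Set E4) : Prop :=
  ∃ φ : E4 ≃ₗᵢ[ℝ] E4, φ ζ = ζ ∧ (∃ x : E4, ⟪x, ζ⟫ = 0 ∧ φ x ≠ x) ∧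
    ∃ a : E4, ⟪a, ζ⟫ = 0 ∧ φ '' D = (fun x => x + a) '' D

/-- A diameter of a convex body `K`: a chord of `K` realizing the maximal width. -/
def IsDiamSeg (K : Set E4) (z y : E4) : Prop :=
  segment ℝ z y ⊆ K ∧ dist z y = maxWidth K

/-- The set `Ω = {w ∈ S²(ζ) : (A_K ∪ A_L) ∩ S²(w) = {±ζ}}`, where `A_K`, `A_L` are
the sets of directions of diameters of `K` and `L`. -/
def Omega (K L : Set E4) (ζ : E4) : Set E4 :=
  {w ∈ S2 ζ | (DiamDirs K ∪ DiamDirs L) ∩ S2 w = {ζ, -ζ}}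

/-- The support function of a compact set is continuous. -/
lemma continuous_suppFn {K : Set E4} (hK : IsCompact K) : Continuous (suppFn K) :=
  hK.continuous_sSup (f := fun x y => ⟪x, y⟫) (by fun_prop)

lemma continuous_widthFn {K : Set E4} (hK : IsCompact K) : Continuous (widthFn K) :=
  (continuous_suppFn hK).add ((continuous_suppFn hK).comp continuous_neg)

lemma widthFn_neg (K : Set E4) (x : E4) : widthFn K (-x) = widthFn K x := by
  simp [widthFn, add_comm]

lemma neg_mem_sph {x : E4} (hx : x ∈ sph) : -x ∈ sph := by
  simpa [sph] using hx

lemma neg_mem_DiamDirs {K : Set E4} {x : E4} (hx : x ∈ DiamDirs K) : -x ∈ DiamDirs K :=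
  ⟨neg_mem_sph hx.1, by rw [widthFn_neg, hx.2]⟩

lemma isCompact_image_widthFn {K : Set E4} (hK : IsCompact K) : IsCompact (widthFn K '' sph) :=
  (isCompact_sphere (0 : E4) 1).image (continuous_widthFn hK)

lemma widthFn_le_maxWidth {K : Set E4} (hK : IsCompact K) {x : E4} (hx : x ∈ sph) :
    widthFn K x ≤ maxWidth K :=
  le_csSup (isCompact_image_widthFn hK).bddAbove ⟨x, hx, rfl⟩

lemma DiamDirs_nonempty {K : Set E4} (hK : IsCompact K) : (DiamDirs K).Nonempty := by
  have hne : sph.Nonempty := NormedSpace.sphere_nonempty.2 zero_le_one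
  obtain ⟨x, hx, h⟩ := (isCompact_image_widthFn hK).sSup_mem (hne.image _)
  exact ⟨x, hx, h⟩

lemma suppFn_projHyp (K : Set E4) {w x : E4} (hx : ⟪x, w⟫ = 0) :
    suppFn (projHyp w '' K) x = suppFn K x := by
  simp [suppFn, Set.image_image, projHyp, inner_sub_right, inner_smul_right, hx]

lemma suppFn_image_isometry (K : Set E4) (φ : E4 ≃ₗᵢ[ℝ] E4) (x : E4) :
    suppFn (φ '' K) (φ x) = suppFn K x := by
  simp [suppFn, Set.image_image]

lemma suppFn_add_right {K : Set E4} (hK : IsCompact K) (hne : K.Nonempty) (a x : E4) :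
    suppFn ((fun y => y + a) '' K) x = suppFn K x + ⟪x, a⟫ := by
  have hb : BddAbove ((fun y => ⟪x, y⟫) '' K) :=
    (hK.image (f := fun y => ⟪x, y⟫) (by fun_prop)).bddAbove
  have h := (OrderIso.addRight ⟪x, a⟫).map_csSup' (hne.image _) hb
  rw [Set.image_image] at h
  rw [suppFn, Set.image_image]
  simpa [suppFn, inner_add_right] using h.symm

/-- A rigid motion of `w^⊥` carrying `K|w^⊥` onto `L|w^⊥` transports the width function. -/
lemma widthFn_eq_of_image_projHyp {K L : Set E4} (hL : IsCompact L) (hne : L.Nonempty)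
    {w a : E4} {χ : E4 ≃ₗᵢ[ℝ] E4} (hw : χ w = w)
    (h : χ '' (projHyp w '' K) = (fun x => x + a) '' (projHyp w '' L))
    {x : E4} (hx : ⟪x, w⟫ = 0) : widthFn L (χ x) = widthFn K x := by
  have hc : IsCompact (projHyp w '' L) := hL.image (by unfold projHyp; fun_prop)
  have key : ∀ y : E4, ⟪y, w⟫ = 0 → suppFn K y = suppFn L (χ y) + ⟪χ y, a⟫ := by
    intro y hy
    have hy' : ⟪χ y, w⟫ = 0 := by
      rw [← hw, χ.inner_map_map, hy]
    rw [← suppFn_projHyp K hy, ← suppFn_image_isometry _ χ, h,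
      suppFn_add_right hc (hne.image _), suppFn_projHyp L hy']
  have h₁ := key x hx
  have h₂ := key (-x) (by rw [inner_neg_left, hx, neg_zero])
  rw [map_neg, inner_neg_left] at h₂
  unfold widthFn
  linarith

/-- Any two vectors of `ℝ⁴` have a common orthogonal unit vector. -/
lemma exists_mem_S2_inner_eq_zero (x y : E4) : ∃ w ∈ S2 x, ⟪y, w⟫ = 0 := by
  have hlt : Module.finrank ℝ (ℝ × ℝ) < Module.finrank ℝ E4 := by simp
  obtain ⟨v, hv, hv0⟩ := (Submodule.ne_bot_iff _).1 (LinearMap.ker_ne_bot_of_finrank_lt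
    (f := ((innerSL ℝ x).prod (innerSL ℝ y) : E4 →L[ℝ] ℝ × ℝ).toLinearMap) hlt)
  have hv' : ⟪x, v⟫ = 0 ∧ ⟪y, v⟫ = 0 := by simpa using hv
  refine ⟨‖v‖⁻¹ • v, ⟨?_, ?_⟩, ?_⟩
  · simp [sph, norm_smul, hv0]
  · rw [real_inner_comm, inner_smul_right, hv'.1, mul_zero]
  · rw [inner_smul_right, hv'.2, mul_zero]

/-- The vectors of `ζ^⊥` not orthogonal to a unit vector `η ≠ ±ζ` are dense in `ζ^⊥`. -/
lemma dense_inner_ne_zero {ζ η : E4} (hζ : ζ ∈ sph) (hη : η ∈ sph)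
    (hne : η ≠ ζ) (hne' : η ≠ -ζ) :
    Dense {v : (ℝ ∙ ζ)ᗮ | ⟪η, (v : E4)⟫ ≠ 0} := by
  have hζ1 : ‖ζ‖ = 1 := by simpa [sph] using hζ
  have hη1 : ‖η‖ = 1 := by simpa [sph] using hη
  let f : (ℝ ∙ ζ)ᗮ →ₗ[ℝ] ℝ := (innerSL ℝ η).toLinearMap ∘ₗ (ℝ ∙ ζ)ᗮ.subtype
  have hf : ∀ v : (ℝ ∙ ζ)ᗮ, f v = ⟪η, (v : E4)⟫ := fun v => by simp [f]
  have hset : {v : (ℝ ∙ ζ)ᗮ | ⟪η, (v : E4)⟫ ≠ 0} = ((LinearMap.ker f : Set (ℝ ∙ ζ)ᗮ))ᶜ := by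
    ext v
    simp [hf]
  rw [hset, ← interior_eq_empty_iff_dense_compl]
  by_contra hint
  have htop := Submodule.eq_top_of_nonempty_interior' (LinearMap.ker f)
    (Set.nonempty_iff_ne_empty.2 hint)
  set c : ℝ := ⟪ζ, η⟫
  have hort : ⟪ζ, η - c • ζ⟫ = 0 := by
    rw [inner_sub_right, inner_smul_right, real_inner_self_eq_norm_sq, hζ1]
    simp [c]
  have hmem : η - c • ζ ∈ (ℝ ∙ ζ)ᗮ := Submodule.mem_orthogonal_singleton_iff_inner_right.2 hort
  have h0 : f ⟨η - c • ζ, hmem⟩ = 0 := by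
    have : (⟨η - c • ζ, hmem⟩ : (ℝ ∙ ζ)ᗮ) ∈ LinearMap.ker f := htop ▸ Submodule.mem_top
    exact this
  rw [hf] at h0
  have hself : ⟪η - c • ζ, η - c • ζ⟫ = 0 := by
    nth_rewrite 1 [inner_sub_left]
    rw [h0, real_inner_smul_left, hort, mul_zero, sub_zero]
  have hηc : η = c • ζ := sub_eq_zero.1 (inner_self_eq_zero.1 hself)
  have hc : |c| = 1 := by
    have := hη1
    rwa [hηc, norm_smul, hζ1, mul_one, Real.norm_eq_abs] at this
  rcases eq_or_eq_neg_of_abs_eq hc with h | h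
  · exact hne (by rw [hηc, h, one_smul])
  · exact hne' (by rw [hηc, h, neg_one_smul])

/-- For a countable set `A` of directions, generic `w ∈ S²(ζ)` are orthogonal to no element of `A`
other than `±ζ`. -/
lemma S2_subset_closure_of_countable {A : Set E4} (hA : A.Countable) (hAs : A ⊆ sph)
    {ζ : E4} (hζ : ζ ∈ sph) :
    S2 ζ ⊆ closure {w ∈ S2 ζ | A ∩ S2 w ⊆ {ζ, -ζ}} := by
  intro w hw
  have hw1 : ‖w‖ = 1 := by simpa [sph] using hw.1
  have hd : Dense (⋂ η ∈ A \ {ζ, -ζ}, {v : (ℝ ∙ ζ)ᗮ | ⟪η, (v : E4)⟫ ≠ 0}) := by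
    refine dense_biInter_of_isOpen (fun η _ => ?_) (hA.mono Set.sdiff_subset) (fun η hη => ?_)
    · exact isOpen_ne_fun (by fun_prop) continuous_const
    · have hη' : η ≠ ζ ∧ η ≠ -ζ := by simpa using hη.2
      exact dense_inner_ne_zero hζ (hAs hη.1) hη'.1 hη'.2
  let w' : (ℝ ∙ ζ)ᗮ := ⟨w, Submodule.mem_orthogonal_singleton_iff_inner_left.2 hw.2⟩
  have hw0 : w' ≠ 0 := by
    intro h
    have : w = 0 := congrArg Subtype.val h
    simp [this] at hw1
  have hfreq := (mem_closure_iff_frequently.1 (hd w')).and_eventually (isOpen_ne.mem_nhds hw0)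
  have hcont : Filter.Tendsto (fun v : (ℝ ∙ ζ)ᗮ => ‖(v : E4)‖⁻¹ • (v : E4)) (nhds w') (nhds w) := by
    have hc : Filter.Tendsto (fun v : (ℝ ∙ ζ)ᗮ => (v : E4)) (nhds w') (nhds w) :=
      continuous_subtype_val.tendsto w'
    simpa [hw1] using (hc.norm.inv₀ (by simp [hw1])).smul hc
  refine mem_closure_iff_frequently.2 (hcont.frequently (hfreq.mono ?_))
  rintro v ⟨hv, hv0⟩
  have hv0' : (v : E4) ≠ 0 := fun h => hv0 (Subtype.ext h)
  have hvn : ‖(v : E4)‖⁻¹ ≠ 0 := inv_ne_zero (norm_ne_zero_iff.2 hv0')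
  refine ⟨⟨by simp [sph, norm_smul, hv0'], ?_⟩, ?_⟩
  · rw [real_inner_smul_left, Submodule.mem_orthogonal_singleton_iff_inner_left.1 v.2, mul_zero]
  · rintro η ⟨hηA, hηs, hη⟩
    by_contra hηζ
    rw [inner_smul_right] at hη
    exact (Set.mem_iInter₂.1 hv η ⟨hηA, hηζ⟩) ((mul_eq_zero.1 hη).resolve_left hvn)

/-- Lemma: `L` has a diameter parallel to `ζ`, the set `Ω` is dense in
`S²(ζ)`, every congruence rotation maps `ζ` to `±ζ`, and `ω_K(ζ) = ω_L(ζ)`. -/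
theorem stmt_11 (K L : Set E4) (hK : IsConvexBody K) (hL : IsConvexBody L)
    (hKc : (DiamDirs K).Countable) (hLc : (DiamDirs L).Countable)
    (ζ : E4) (hζ : ζ ∈ sph) (hζK : ζ ∈ DiamDirs K)
    (hcong : ∀ w ∈ S2 ζ, DirCong w (projHyp w '' K) (projHyp w '' L)) :
    ζ ∈ DiamDirs L ∧
    S2 ζ ⊆ closure (Omega K L ζ) ∧
    (∀ w ∈ Omega K L ζ, ∀ (χ : E4 ≃ₗᵢ[ℝ] E4) (a : E4), IsRot w χ → ⟪a, w⟫ = 0 →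
      χ '' (projHyp w '' K) = (fun x => x + a) '' (projHyp w '' L) →
      (χ ζ = ζ ∨ χ ζ = -ζ)) ∧
    widthFn K ζ = widthFn L ζ := by
  have hLne : L.Nonempty := hL.2.2.mono interior_subset
  have hsph : ∀ (χ : E4 ≃ₗᵢ[ℝ] E4) {x : E4}, x ∈ sph → χ x ∈ sph := fun χ x hx => by
    simpa [sph] using hx
  have hmax : maxWidth K = maxWidth L := by
    apply le_antisymm
    · obtain ⟨w, hw, -⟩ := exists_mem_S2_inner_eq_zero ζ ζ
      obtain ⟨χ, hχ, a, -, h⟩ := hcong w hw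
      rw [← hζK.2, ← widthFn_eq_of_image_projHyp hL.1 hLne hχ.1 h
        ((real_inner_comm _ _).trans hw.2)]
      exact widthFn_le_maxWidth hL.1 (hsph χ hζ)
    · obtain ⟨η, hη⟩ := DiamDirs_nonempty hL.1
      obtain ⟨w, hw, hηw⟩ := exists_mem_S2_inner_eq_zero ζ η
      obtain ⟨χ, hχ, a, -, h⟩ := hcong w hw
      have hort : ⟪χ.symm η, w⟫ = 0 := by
        rw [← χ.inner_map_map, χ.apply_symm_apply, hχ.1, hηw]
      have hwid := widthFn_eq_of_image_projHyp hL.1 hLne hχ.1 h hort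
      rw [χ.apply_symm_apply] at hwid
      rw [← hη.2, hwid]
      exact widthFn_le_maxWidth hK.1 (hsph χ.symm hη.1)
  have hmap : ∀ w ∈ S2 ζ, ∀ (χ : E4 ≃ₗᵢ[ℝ] E4) (a : E4), IsRot w χ →
      χ '' (projHyp w '' K) = (fun x => x + a) '' (projHyp w '' L) →
      χ ζ ∈ DiamDirs L ∩ S2 w := by
    intro w hw χ a hχ h
    have hζw : ⟪ζ, w⟫ = 0 := (real_inner_comm _ _).trans hw.2
    refine ⟨⟨hsph χ hζ, ?_⟩, hsph χ hζ, ?_⟩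
    · rw [widthFn_eq_of_image_projHyp hL.1 hLne hχ.1 h hζw, hζK.2, hmax]
    · rw [← hχ.1, χ.inner_map_map, hζw]
  have hdense := S2_subset_closure_of_countable (hKc.union hLc)
    (Set.union_subset (fun _ h => h.1) (fun _ h => h.1)) hζ
  have hζL : ζ ∈ DiamDirs L := by
    obtain ⟨w₀, hw₀, -⟩ := exists_mem_S2_inner_eq_zero ζ ζ
    obtain ⟨w, hw, hsub⟩ := closure_nonempty_iff.1 ⟨w₀, hdense hw₀⟩
    obtain ⟨χ, hχ, a, -, h⟩ := hcong w hw
    have hm := hmap w hw χ a hχ h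
    rcases hsub ⟨Or.inr hm.1, hm.2⟩ with h | h
    · exact h ▸ hm.1
    · have hneg := neg_mem_DiamDirs hm.1
      rwa [Set.mem_singleton_iff.1 h, neg_neg] at hneg
  refine ⟨hζL, hdense.trans (closure_mono ?_), ?_, by rw [hζK.2, hζL.2, hmax]⟩
  · rintro w ⟨hw, hsub⟩
    have hζw : ⟪ζ, w⟫ = 0 := (real_inner_comm _ _).trans hw.2
    refine ⟨hw, hsub.antisymm ?_⟩
    rintro x (rfl | rfl)
    · exact ⟨Or.inl hζK, hζ, hζw⟩
    · exact ⟨Or.inl (neg_mem_DiamDirs hζK), neg_mem_sph hζ, by rw [inner_neg_left, hζw, neg_zero]⟩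
  · intro w hw χ a hχ _ h
    have hm := hmap w hw.1 χ a hχ h
    have : χ ζ ∈ ({ζ, -ζ} : Set E4) := hw.2 ▸ ⟨Or.inr hm.1, hm.2⟩
    simpa using this
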